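/- For any odd prime p and any integer x, we have ∑_{k=0}^{p-1} (2k+1) A_k(x) ≡ p · (x/p) (mod p²), where (x/p) denotes the Legendre symbol. -/

import Mathlib

/-- The Apéry polynomial `A_n(x) = ∑_{k=0}^n C(n,k)² C(n+k,k)² x^k`. -/
def aperyPoly (n : ℕ) (x : ℤ) : ℤ :=
  ∑ k ∈ Finset.range (n + 1), (n.choose k : ℤ) ^ 2 * ((n + k).choose k : ℤ) ^ 2 * x ^ k

/-- The summand of the Apéry polynomials telescopes:
`(2k+1) ∑_{n<N} (2n+1) C(n,k)² C(n+k,k)² = ((N-k) C(N,k) C(N+k,k))²`. -/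
lemma two_mul_add_one_mul_sum_choose_sq (k N : ℕ) :
    (2 * (k : ℤ) + 1) * ∑ n ∈ Finset.range N,
        (2 * (n : ℤ) + 1) * ((n.choose k : ℤ) ^ 2 * ((n + k).choose k : ℤ) ^ 2) =
      (((N : ℤ) - k) * N.choose k * (N + k).choose k) ^ 2 := by
  induction N with
  | zero => cases k <;> simp
  | succ N ih =>
    have h1 : ((N : ℤ) + 1 - k) * (N + 1).choose k = (N + 1) * N.choose k := by
      rcases le_or_gt k (N + 1) with hk | hk
      · have := Nat.choose_mul_succ_eq N k
        zify [hk] at this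
        linear_combination -this
      · simp [Nat.choose_eq_zero_of_lt hk, Nat.choose_eq_zero_of_lt (show N < k by lia)]
    have h2 : ((N : ℤ) + 1) * (N + 1 + k).choose k = (N + 1 + k) * (N + k).choose k := by
      have := Nat.choose_mul_succ_eq (N + k) k
      rw [show N + k + 1 - k = N + 1 by lia, show N + k + 1 = N + 1 + k by lia] at this
      zify at this
      linear_combination -this
    have h3 : ((N : ℤ) + 1 - k) * (N + 1).choose k * (N + 1 + k).choose k =
        (N + 1 + k) * N.choose k * (N + k).choose k := by
      linear_combination ((N + 1 + k).choose k : ℤ) * h1 + (N.choose k : ℤ) * h2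
    rw [Finset.sum_range_succ, mul_add, ih]
    push_cast
    rw [h3]
    ring

lemma ZMod.natCast_choose_prime_sub_one (p : ℕ) [hp : Fact p.Prime] {k : ℕ} (hk : k < p) :
    ((p - 1).choose k : ZMod p) = (-1) ^ k := by
  induction k with
  | zero => simp
  | succ k ih =>
    have h := Nat.choose_succ_succ (p - 1) k
    rw [Nat.succ_eq_add_one, Nat.succ_eq_add_one, Nat.sub_add_cancel hp.out.one_le] at h
    have h0 : (p.choose (k + 1) : ZMod p) = 0 :=
      (ZMod.natCast_eq_zero_iff _ _).2 (hp.out.dvd_choose_self k.succ_ne_zero hk)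
    rw [h, Nat.cast_add, ih (by lia)] at h0
    linear_combination h0

lemma ZMod.natCast_choose_prime_add (p : ℕ) [hp : Fact p.Prime] {k : ℕ} (hk : k < p) :
    ((p + k).choose k : ZMod p) = 1 := by
  have h := (ZMod.natCast_eq_natCast_iff _ _ p).2 (Choose.choose_modEq_choose_mod_mul_choose_div_nat
    (n := p + k) (k := k) (p := p))
  simpa [Nat.mod_eq_of_lt hk, Nat.div_eq_of_lt hk] using h

/-- The coefficient of `x ^ k` in `∑_{n<p} (2n+1) A_n(x)`, modulo `p²`. -/
lemma sum_choose_sq_modEq (p : ℕ) [hp : Fact p.Prime] {k : ℕ} (hk : k < p) :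
    ∑ n ∈ Finset.range p,
        (2 * (n : ℤ) + 1) * ((n.choose k : ℤ) ^ 2 * ((n + k).choose k : ℤ) ^ 2) ≡
      (if 2 * k + 1 = p then (p : ℤ) else 0) [ZMOD (p : ℤ) ^ 2] := by
  have hT := two_mul_add_one_mul_sum_choose_sq k p
  have hc : ((p : ℤ) - k) * p.choose k = p * (p - 1).choose k := by
    have h := Nat.choose_mul_succ_eq (p - 1) k
    rw [Nat.sub_add_cancel hp.out.one_le] at h
    zify [hk.le] at h
    linear_combination -h
  rw [hc] at hT
  set T := ∑ n ∈ Finset.range p,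
    (2 * (n : ℤ) + 1) * ((n.choose k : ℤ) ^ 2 * ((n + k).choose k : ℤ) ^ 2)
  have hp0 : (p : ℤ) ≠ 0 := by exact_mod_cast hp.out.ne_zero
  split_ifs with h
  · have hkp : (2 * (k : ℤ) + 1) = p := by exact_mod_cast h
    have hT' : T = p * (((p - 1).choose k : ℤ) * (p + k).choose k) ^ 2 := by
      apply mul_left_cancel₀ hp0
      rw [hkp] at hT
      linear_combination hT
    have h1 : (((p - 1).choose k : ℤ) * (p + k).choose k) ^ 2 ≡ 1 [ZMOD p] := by
      rw [← ZMod.intCast_eq_intCast_iff]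
      push_cast
      rw [ZMod.natCast_choose_prime_sub_one p hk, ZMod.natCast_choose_prime_add p hk, mul_one,
        ← pow_mul, mul_comm, pow_mul]
      simp
    rw [hT', sq (p : ℤ)]
    simpa using h1.mul_left' (c := (p : ℤ))
  · have hcop : IsCoprime ((p : ℤ) ^ 2) (2 * (k : ℤ) + 1) := by
      have : Nat.Coprime p (2 * k + 1) := by
        rw [hp.out.coprime_iff_not_dvd]
        rintro ⟨m, hm⟩
        have : m < 2 := by
          by_contra! hm2
          nlinarith
        interval_cases m <;> lia
      exact IsCoprime.pow_left (by exact_mod_cast Nat.isCoprime_iff_coprime.2 this)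
    refine Int.modEq_zero_iff_dvd.2 (hcop.dvd_of_dvd_mul_left ?_)
    rw [hT]
    exact ⟨(((p - 1).choose k : ℤ) * (p + k).choose k) ^ 2, by ring⟩

lemma aperyPoly_eq_sum_range {n N : ℕ} (h : n < N) (x : ℤ) :
    aperyPoly n x = ∑ k ∈ Finset.range N,
      (n.choose k : ℤ) ^ 2 * ((n + k).choose k : ℤ) ^ 2 * x ^ k := by
  refine Finset.sum_subset (Finset.range_mono h) fun k _ hk => ?_
  simp [Nat.choose_eq_zero_of_lt (show n < k by simpa using hk)]

/-- For any odd prime `p` and any integer `x`,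
`∑_{k=0}^{p-1} (2k+1) A_k(x) ≡ p (x/p) (mod p²)`, with `(x/p)` the Legendre symbol. -/
theorem sum_two_k_add_one_apery_legendre (p : ℕ) [Fact p.Prime] (hp2 : p ≠ 2) (x : ℤ) :
    ∑ k ∈ Finset.range p, (2 * (k : ℤ) + 1) * aperyPoly k x ≡
      (p : ℤ) * legendreSym p x [ZMOD (p : ℤ) ^ 2] := by
  have hodd : 2 * (p / 2) + 1 = p :=
    Nat.two_mul_div_two_add_one_of_odd ((Fact.out : p.Prime).odd_of_ne_two hp2)
  have hswap : ∑ k ∈ Finset.range p, (2 * (k : ℤ) + 1) * aperyPoly k x =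
      ∑ k ∈ Finset.range p, (∑ n ∈ Finset.range p,
        (2 * (n : ℤ) + 1) * ((n.choose k : ℤ) ^ 2 * ((n + k).choose k : ℤ) ^ 2)) * x ^ k := by
    simp_rw [Finset.sum_mul]
    rw [Finset.sum_comm]
    refine Finset.sum_congr rfl fun n hn => ?_
    rw [aperyPoly_eq_sum_range (Finset.mem_range.1 hn), Finset.mul_sum]
    exact Finset.sum_congr rfl fun k _ => by ring
  have hcoeff : ∑ k ∈ Finset.range p, (∑ n ∈ Finset.range p,
        (2 * (n : ℤ) + 1) * ((n.choose k : ℤ) ^ 2 * ((n + k).choose k : ℤ) ^ 2)) * x ^ k ≡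
      ∑ k ∈ Finset.range p, (if 2 * k + 1 = p then (p : ℤ) else 0) * x ^ k
        [ZMOD (p : ℤ) ^ 2] :=
    Int.ModEq.sum fun k hk => (sum_choose_sq_modEq p (Finset.mem_range.1 hk)).mul_right _
  have hsingle : ∑ k ∈ Finset.range p, (if 2 * k + 1 = p then (p : ℤ) else 0) * x ^ k =
      p * x ^ (p / 2) := by
    rw [Finset.sum_eq_single_of_mem (p / 2) (Finset.mem_range.2 (by lia)), if_pos hodd]
    intro k _ hk
    rw [if_neg (by lia), zero_mul]
  have hpow : x ^ (p / 2) ≡ legendreSym p x [ZMOD p] := by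
    rw [← ZMod.intCast_eq_intCast_iff, legendreSym.eq_pow]
    push_cast
    rfl
  rw [hswap]
  refine hcoeff.trans ?_
  rw [hsingle, sq]
  exact hpow.mul_left'
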